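/- arXiv:2406.06754 — 4 statements merged into one kernel-verified Lean document; each statement's English description precedes it below -/
import Mathlib

section
/- Let V be a finite type, p a forest on V, and p' obtained from p by a single size-respecting link step (p' = Function.update p r₁ r₂ with r₁ ≠ r₂ roots of p and treeSize_p r₁ ≤ treeSize_p r₂). Then p' is again a forest, and for every vertex v : V: depth_{p'} v ≤ depth_p v + 1, and if depth_{p'} v = depth_p v + 1 then treeSize_{p'} v ≥ 2 * treeSize_p v. (A vertex's depth increases by at most one per union-by-size link, and whenever it increases, the size of the vertex's tree at least doubles.) -/
/-- A vertex `v` is a root of the parent function `p` if `p v = v`. -/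
def IsRoot {V : Type*} (p : V → V) (v : V) : Prop := p v = v

/-- A parent function is a forest if iterating it from any vertex eventually
reaches a fixpoint. -/
def IsForest {V : Type*} (p : V → V) : Prop := ∀ v : V, ∃ k : ℕ, p (p^[k] v) = p^[k] v

/-- The depth of `v` in the forest `p`: the least `k` with `p^[k] v = p^[k+1] v`. -/
noncomputable def depth {V : Type*} (p : V → V) (v : V) : ℕ :=
  sInf {k : ℕ | p^[k] v = p^[k + 1] v}

/-- The root of `v` in the forest `p`: the fixpoint reached by iterating `p`. -/
noncomputable def root {V : Type*} (p : V → V) (v : V) : V := p^[depth p v] v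

/-- The size of the tree of `v`: the number of vertices with the same root. -/
noncomputable def treeSize {V : Type*} (p : V → V) (v : V) : ℕ :=
  Set.ncard {w : V | root p w = root p v}

theorem aux_root_fix {V : Type*} {p : V → V} (hp : IsForest p) (v : V) :
    p (root p v) = root p v := by
  have hn : {k : ℕ | p^[k] v = p^[k + 1] v}.Nonempty := by
    obtain ⟨k, hk⟩ := hp v
    exact ⟨k, by simp only [Set.mem_ofPred_eq, Function.iterate_succ_apply', hk]⟩
  have h : p^[depth p v] v = p^[depth p v + 1] v := Nat.sInf_mem hn
  rw [Function.iterate_succ_apply'] at h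
  exact h.symm

theorem aux_depth_le {V : Type*} {p : V → V} {v : V} {k : ℕ}
    (h : p (p^[k] v) = p^[k] v) : depth p v ≤ k := by
  apply Nat.sInf_le
  simp only [Set.mem_ofPred_eq, Function.iterate_succ_apply', h]

theorem aux_root_eq {V : Type*} {p : V → V} (hp : IsForest p) {v : V} {k : ℕ}
    (h : p (p^[k] v) = p^[k] v) : root p v = p^[k] v := by
  have hle := aux_depth_le h
  obtain ⟨m, rfl⟩ := Nat.exists_eq_add_of_le hle
  rw [Nat.add_comm, Function.iterate_add_apply]
  exact (Function.iterate_fixed (aux_root_fix hp v) m).symm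

/-- A vertex's depth increases by at most one per union-by-size link, and
whenever it increases, the size of the vertex's tree at least doubles. -/
theorem sizeRespectingLink_depth {V : Type*} [Fintype V] [DecidableEq V] (p : V → V) (hp : IsForest p)
    (r₁ r₂ : V) (hne : r₁ ≠ r₂) (h₁ : IsRoot p r₁) (h₂ : IsRoot p r₂)
    (hsize : treeSize p r₁ ≤ treeSize p r₂)
    (p' : V → V) (hp' : p' = Function.update p r₁ r₂) :
    IsForest p' ∧ ∀ v : V,
      depth p' v ≤ depth p v + 1 ∧
      (depth p' v = depth p v + 1 → 2 * treeSize p v ≤ treeSize p' v) := by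
  subst hp'
  have key : ∀ v k, k ≤ depth p v → (Function.update p r₁ r₂)^[k] v = p^[k] v := by
    intro v k
    induction k with
    | zero => intro _; rfl
    | succ k ih =>
      intro hk
      rw [Function.iterate_succ_apply', Function.iterate_succ_apply', ih (by omega)]
      apply Function.update_of_ne
      intro he
      have : depth p v ≤ k := aux_depth_le (by rw [he]; exact h₁)
      omega
  have hr2 : Function.update p r₁ r₂ r₂ = r₂ := by
    rw [Function.update_of_ne hne.symm]; exact h₂
  have hA : ∀ v, root p v ≠ r₁ → (Function.update p r₁ r₂)^[depth p v] v = root p v ∧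
      Function.update p r₁ r₂ (root p v) = root p v := by
    intro v hv
    exact ⟨key v _ le_rfl, by rw [Function.update_of_ne hv]; exact aux_root_fix hp v⟩
  have hB : ∀ v, root p v = r₁ → (Function.update p r₁ r₂)^[depth p v + 1] v = r₂ := by
    intro v hv
    rw [Function.iterate_succ_apply', key v _ le_rfl]
    change Function.update p r₁ r₂ (root p v) = r₂
    rw [hv, Function.update_self]
  have hF : IsForest (Function.update p r₁ r₂) := by
    intro v
    by_cases hv : root p v = r₁
    · exact ⟨_, by rw [hB v hv, hr2]⟩
    · exact ⟨_, by rw [(hA v hv).1, (hA v hv).2]⟩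
  have dA : ∀ v, root p v ≠ r₁ → depth (Function.update p r₁ r₂) v ≤ depth p v := fun v hv =>
    aux_depth_le (by rw [(hA v hv).1, (hA v hv).2])
  have rA : ∀ v, root p v ≠ r₁ → root (Function.update p r₁ r₂) v = root p v := fun v hv =>
    (aux_root_eq hF (by rw [(hA v hv).1, (hA v hv).2])).trans (hA v hv).1
  have dB : ∀ v, root p v = r₁ → depth (Function.update p r₁ r₂) v ≤ depth p v + 1 := fun v hv =>
    aux_depth_le (by rw [hB v hv, hr2])
  have rB : ∀ v, root p v = r₁ → root (Function.update p r₁ r₂) v = r₂ := fun v hv =>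
    (aux_root_eq hF (by rw [hB v hv, hr2])).trans (hB v hv)
  refine ⟨hF, fun v => ⟨?_, fun hd => ?_⟩⟩
  · by_cases hv : root p v = r₁
    · exact dB v hv
    · exact (dA v hv).trans (Nat.le_succ _)
  · have hv : root p v = r₁ := by
      by_contra hv
      have := dA v hv
      omega
    have e1 : root p r₁ = r₁ := aux_root_eq hp (k := 0) h₁
    have e2 : root p r₂ = r₂ := aux_root_eq hp (k := 0) h₂
    unfold treeSize at *
    rw [e1, e2] at hsize
    rw [hv, rB v hv]
    have hdis : Disjoint {w : V | root p w = r₁} {w : V | root p w = r₂} := by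
      rw [Set.disjoint_left]
      intro w hw hw'
      exact hne (hw.symm.trans hw')
    have hu := Set.ncard_union_eq hdis (Set.toFinite _) (Set.toFinite _)
    have hsub : {w : V | root p w = r₁} ∪ {w : V | root p w = r₂} ⊆
        {w : V | root (Function.update p r₁ r₂) w = r₂} := by
      rintro w (hw | hw)
      · exact rB w hw
      · have hw : root p w = r₂ := hw
        exact (rA w (by rw [hw]; exact hne.symm)).trans hw
    have := Set.ncard_le_ncard hsub (Set.toFinite _)
    omega
end

section
/- Let V be a finite type and let p : V → V be obtained from the discrete forest (the identity function) by a finite sequence of size-respecting link steps. Then p is a forest, and for every vertex v : V, 2^(depth_p v) ≤ treeSize_p v ≤ Fintype.card V; in particular depth_p v ≤ Nat.log 2 (Fintype.card V). (Paper's Lemma 4.2: in an optimized Union-Find tree built by union-by-size, the find operation visits at most log₂ of the tree size many vertices.) -/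
/-- A size-respecting link step (union by size): the root of the smaller tree
becomes a child of the root of the larger tree. -/
def LinkStep {V : Type*} [DecidableEq V] (p p' : V → V) : Prop :=
  ∃ r₁ r₂ : V, r₁ ≠ r₂ ∧ IsRoot p r₁ ∧ IsRoot p r₂ ∧
    treeSize p r₁ ≤ treeSize p r₂ ∧ p' = Function.update p r₁ r₂

inductive UBSReach {V : Type*} (p : V → V) : V → ℕ → V → Prop
  | base (v : V) (h : p v = v) : UBSReach p v 0 v
  | step (v : V) (k : ℕ) (r : V) (h : p v ≠ v) (hr : UBSReach p (p v) k r) :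
      UBSReach p v (k + 1) r

theorem UBSReach.spec {V : Type*} {p : V → V} {v : V} {k : ℕ} {r : V} (h : UBSReach p v k r) :
    p^[k] v = r ∧ p r = r ∧ ∀ j, p^[j] v = p^[j + 1] v → k ≤ j := by
  induction h with
  | base v h => simp [h]
  | step v k r h hr ih =>
    obtain ⟨h1, h2, h3⟩ := ih
    refine ⟨by simpa using h1, h2, ?_⟩
    intro j hj
    cases j with
    | zero => exact absurd (by simpa using hj.symm) h
    | succ j =>
      have := h3 j (by simpa [Function.iterate_succ_apply] using hj)
      omega

theorem UBSReach.depth_eq {V : Type*} {p : V → V} {v : V} {k : ℕ} {r : V}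
    (h : UBSReach p v k r) : depth p v = k := by
  obtain ⟨h1, h2, h3⟩ := h.spec
  have hk : k ∈ {k : ℕ | p^[k] v = p^[k + 1] v} := by
    simp only [Set.mem_setOf_eq, Function.iterate_succ_apply', h1, h2]
  exact le_antisymm (Nat.sInf_le hk) (h3 _ (Nat.sInf_mem ⟨k, hk⟩))

theorem UBSReach.root_eq {V : Type*} {p : V → V} {v : V} {k : ℕ} {r : V}
    (h : UBSReach p v k r) : root p v = r := by
  rw [root, h.depth_eq, h.spec.1]

theorem UBSReach.link {V : Type*} [DecidableEq V] {p : V → V} {r₁ r₂ : V} (hne : r₁ ≠ r₂)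
    (h1 : p r₁ = r₁) (h2 : p r₂ = r₂) {v : V} {k : ℕ} {r : V} (h : UBSReach p v k r) :
    UBSReach (Function.update p r₁ r₂) v (if r = r₁ then k + 1 else k)
      (if r = r₁ then r₂ else r) := by
  induction h with
  | base v h =>
    by_cases hv : v = r₁
    · subst hv
      simp only [if_true]
      refine .step _ _ _ (by simpa using hne.symm) ?_
      rw [Function.update_self]
      exact .base _ (by rw [Function.update_of_ne hne.symm, h2])
    · simp only [if_neg hv]
      exact .base _ (by rw [Function.update_of_ne hv, h])
  | step v k r h hr ih =>
    have hv : v ≠ r₁ := by rintro rfl; exact h h1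
    have e : Function.update p r₁ r₂ v = p v := Function.update_of_ne hv _ _
    have := UBSReach.step (p := Function.update p r₁ r₂) v _ _ (by rw [e]; exact h)
      (by rw [e]; exact ih)
    split_ifs at this ⊢ <;> exact this

theorem unionBySize_invariant {V : Type*} [Fintype V] [DecidableEq V] (p : V → V)
    (hp : Relation.ReflTransGen LinkStep id p) :
    ∀ v : V, ∃ k r, UBSReach p v k r ∧ 2 ^ k ≤ Set.ncard {w : V | root p w = r} := by
  induction hp with
  | refl =>
    intro v
    refine ⟨0, v, .base _ rfl, ?_⟩
    rw [pow_zero, Nat.one_le_iff_ne_zero, ← Nat.pos_iff_ne_zero, Set.ncard_pos]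
    exact ⟨v, (UBSReach.base v rfl : UBSReach id v 0 v).root_eq⟩
  | @tail p p' _ hs ih =>
    obtain ⟨r₁, r₂, hne, h1, h2, hsz, rfl⟩ := hs
    have hroot : ∀ w, root (Function.update p r₁ r₂) w =
        if root p w = r₁ then r₂ else root p w := by
      intro w
      obtain ⟨k, r, h, -⟩ := ih w
      rw [(h.link hne h1 h2).root_eq, h.root_eq]
    have hsz' : Set.ncard {w : V | root p w = r₁} ≤ Set.ncard {w : V | root p w = r₂} := by
      have e1 := (UBSReach.base r₁ h1).root_eq
      have e2 := (UBSReach.base r₂ h2).root_eq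
      simpa only [treeSize, e1, e2] using hsz
    intro v
    obtain ⟨k, r, h, hk⟩ := ih v
    refine ⟨_, _, h.link hne h1 h2, ?_⟩
    by_cases hr : r = r₁
    · subst hr
      simp only [if_true]
      have hu : {w : V | root p w = r} ∪ {w : V | root p w = r₂} ⊆
          {w : V | root (Function.update p r r₂) w = r₂} := by
        rintro w (hw | hw) <;> simp only [Set.mem_setOf_eq] at hw ⊢ <;> rw [hroot, hw] <;> simp
      have hd : Disjoint {w : V | root p w = r} {w : V | root p w = r₂} := by
        rw [Set.disjoint_left]
        intro w hw hw'
        exact hne (hw.symm.trans hw')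
      have := Set.ncard_le_ncard hu (Set.toFinite _)
      rw [Set.ncard_union_eq hd (Set.toFinite _) (Set.toFinite _)] at this
      rw [pow_succ]
      omega
    · simp only [if_neg hr]
      refine hk.trans (Set.ncard_le_ncard ?_ (Set.toFinite _))
      intro w hw
      simp only [Set.mem_setOf_eq] at hw ⊢
      rw [hroot, hw, if_neg hr]

/-- Lemma 4.2: in an optimized Union-Find tree built by union-by-size, the depth
of every vertex is at most log₂ of the tree size. -/
theorem unionBySize_depth_le_log {V : Type*} [Fintype V] [DecidableEq V] (p : V → V)
    (hp : Relation.ReflTransGen LinkStep id p) :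
    IsForest p ∧ ∀ v : V,
      2 ^ depth p v ≤ treeSize p v ∧ treeSize p v ≤ Fintype.card V ∧
      depth p v ≤ Nat.log 2 (Fintype.card V) := by
  have key := unionBySize_invariant p hp
  refine ⟨fun v => ?_, fun v => ?_⟩
  · obtain ⟨k, r, h, -⟩ := key v
    exact ⟨k, by rw [h.spec.1, h.spec.2.1]⟩
  · obtain ⟨k, r, h, hk⟩ := key v
    have hc : treeSize p v ≤ Fintype.card V := by
      rw [← Nat.card_eq_fintype_card]
      exact Set.ncard_le_card _
    have hd : 2 ^ depth p v ≤ treeSize p v := by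
      rw [treeSize, h.depth_eq, h.root_eq]
      exact hk
    exact ⟨hd, hc, Nat.le_log_of_pow_le (by norm_num) (hd.trans hc)⟩
end

section
/- Let V be a finite type, p a forest on V, and r₁ ≠ r₂ two roots of p. Let p' = Function.update p r₁ r₂ (link r₁ under r₂). Then p' is a forest; the roots of p' are exactly the roots of p other than r₁; and for every vertex v : V, root_{p'} v = r₂ if root_p v = r₁, and root_{p'} v = root_p v otherwise. (Linking two distinct roots preserves the forest structure and merges exactly the two corresponding trees.) -/
theorem root_eq_aux {V : Type*} (p : V → V) (v w : V) (k : ℕ) (hk : p^[k] v = w) (hw : p w = w) :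
    root p v = w := by
  have hmem : k ∈ {k : ℕ | p^[k] v = p^[k + 1] v} := by
    simp only [Set.mem_setOf_eq, Function.iterate_succ_apply', hk, hw]
  have hd : depth p v ∈ {k : ℕ | p^[k] v = p^[k + 1] v} := Nat.sInf_mem ⟨k, hmem⟩
  have hle : depth p v ≤ k := Nat.sInf_le hmem
  simp only [Set.mem_setOf_eq, Function.iterate_succ_apply'] at hd
  unfold root
  rw [← hk]
  obtain ⟨m, hm⟩ := Nat.exists_eq_add_of_le hle
  rw [hm, Nat.add_comm, Function.iterate_add_apply, Function.iterate_fixed hd.symm]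

theorem link_reach_aux {V : Type*} [DecidableEq V] (p : V → V) (r₁ r₂ : V) (h₁ : p r₁ = r₁) (k : ℕ) :
    ∀ v : V, ∃ j : ℕ, (Function.update p r₁ r₂)^[j] v =
      if p^[k] v = r₁ then r₂ else p^[k] v := by
  induction k with
  | zero =>
    intro v
    by_cases hv : v = r₁
    · exact ⟨1, by simp [hv]⟩
    · exact ⟨0, by simp [hv]⟩
  | succ k ih =>
    intro v
    by_cases hv : v = r₁
    · refine ⟨1, ?_⟩
      subst hv
      rw [Function.iterate_fixed h₁]
      simp
    · obtain ⟨j, hj⟩ := ih (p v)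
      refine ⟨j + 1, ?_⟩
      rw [Function.iterate_succ_apply, Function.iterate_succ_apply, Function.update_of_ne hv]
      exact hj

/-- Linking two distinct roots preserves the forest structure and merges exactly
the two corresponding trees. -/
theorem link_roots_merges_trees {V : Type*} [Fintype V] [DecidableEq V] (p : V → V) (hp : IsForest p)
    (r₁ r₂ : V) (hne : r₁ ≠ r₂) (h₁ : IsRoot p r₁) (h₂ : IsRoot p r₂)
    (p' : V → V) (hp' : p' = Function.update p r₁ r₂) :
    IsForest p' ∧
    (∀ v : V, IsRoot p' v ↔ IsRoot p v ∧ v ≠ r₁) ∧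
    ∀ v : V, (root p v = r₁ → root p' v = r₂) ∧
      (root p v ≠ r₁ → root p' v = root p v) := by
  subst hp'
  unfold IsRoot at *
  have key : ∀ v : V, ∃ j : ℕ, (Function.update p r₁ r₂)^[j] v =
      (if root p v = r₁ then r₂ else root p v) := fun v => link_reach_aux p r₁ r₂ h₁ _ v
  have hroot : ∀ v, p (root p v) = root p v := by
    intro v
    obtain ⟨k, hk⟩ := hp v
    rw [root_eq_aux p v _ k rfl hk]
    exact hk
  have hfix : ∀ v, Function.update p r₁ r₂ (if root p v = r₁ then r₂ else root p v) =
      (if root p v = r₁ then r₂ else root p v) := by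
    intro v
    split_ifs with h
    · rw [Function.update_of_ne hne.symm, h₂]
    · rw [Function.update_of_ne h, hroot]
  refine ⟨?_, ?_, ?_⟩
  · intro v
    obtain ⟨j, hj⟩ := key v
    exact ⟨j, by rw [hj, hfix]⟩
  · intro v
    by_cases hv : v = r₁
    · subst hv
      simp [hne.symm]
    · simp [hv]
  · intro v
    obtain ⟨j, hj⟩ := key v
    have := root_eq_aux _ v _ j hj (hfix v)
    exact ⟨fun h => by rw [this, if_pos h], fun h => by rw [this, if_neg h]⟩
end

section
/- Let V be a finite type and consider a sequence p₀ = id, p₁, …, p_m of parent functions on V where each p_k = Function.update p_{k-1} r_k s_k with r_k ≠ s_k both roots of p_{k-1}, and let ℓ₁ ≥ ℓ₂ ≥ … ≥ ℓ_m be a nonincreasing sequence of natural-number labels (ℓ_k is the label of the edge inserted at step k). Then the linked vertices r₁, …, r_m are pairwise distinct, so the label function L with L(r_k) = ℓ_k is well defined on the non-roots of p_m; and in the final forest p = p_m the labels are monotone toward the root: for every vertex v such that p v ≠ v and p (p v) ≠ p v, L (p v) ≤ L v. (This establishes the monotonicity invariant of edge labels in backward buffers: Union-Find tree edges inserted with continuously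 decreasing snapshot indexes have nonincreasing labels along every path toward the root.) -/
/-- Monotonicity invariant of edge labels in backward buffers: linking roots of
successive forests with nonincreasing labels yields pairwise distinct linked
vertices, the non-roots of the final forest are exactly the linked vertices, and
the induced label function is nonincreasing along every path toward the root. -/
theorem backwardBuffer_label_monotone {V : Type*} [Fintype V] [DecidableEq V] (m : ℕ)
    (p : Fin (m + 1) → V → V) (r s : Fin m → V) (ℓ : Fin m → ℕ)
    (h0 : p 0 = id)
    (hstep : ∀ k : Fin m, r k ≠ s k ∧ IsRoot (p k.castSucc) (r k) ∧
      IsRoot (p k.castSucc) (s k) ∧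
      p k.succ = Function.update (p k.castSucc) (r k) (s k))
    (hℓ : Antitone ℓ) :
    Function.Injective r ∧
    (∀ v : V, p (Fin.last m) v ≠ v → ∃ k : Fin m, v = r k) ∧
    ∀ L : V → ℕ, (∀ k : Fin m, L (r k) = ℓ k) →
      ∀ v : V, p (Fin.last m) v ≠ v →
        p (Fin.last m) (p (Fin.last m) v) ≠ p (Fin.last m) v →
        L (p (Fin.last m) v) ≤ L v := by
  have A : ∀ i : Fin (m + 1), ∀ k : Fin m, k.castSucc < i → p i (r k) = s k := by
    intro i
    induction i using Fin.induction with
    | zero => intro k hk; exact absurd hk (Fin.not_lt_zero _)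
    | succ i ih =>
      intro k hk
      obtain ⟨_, h2, _, h4⟩ := hstep i
      rw [h4]
      by_cases hki : k = i
      · subst hki; simp
      · have hlt : k.castSucc < i.castSucc := by
          have h5 : (k : ℕ) ≠ i := fun h => hki (Fin.ext h)
          simp only [Fin.lt_def, Fin.val_castSucc, Fin.val_succ] at hk ⊢
          omega
        have h6 := ih k hlt
        have hne : r k ≠ r i := by
          intro h
          rw [h] at h6
          exact (hstep k).1 (h.trans (h2.symm.trans h6))
        rw [Function.update_of_ne hne, h6]
  have B : ∀ i : Fin (m + 1), ∀ v : V, p i v ≠ v → ∃ k : Fin m, v = r k := by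
    intro i
    induction i using Fin.induction with
    | zero => intro v hv; simp [h0] at hv
    | succ i ih =>
      intro v hv
      by_cases h : v = r i
      · exact ⟨i, h⟩
      · rw [(hstep i).2.2.2, Function.update_of_ne h] at hv
        exact ih v hv
  have C : ∀ j k : Fin m, j < k → ¬ IsRoot (p k.castSucc) (r j) := by
    intro j k hjk h
    have h6 := A k.castSucc j (Fin.castSucc_lt_castSucc_iff.mpr hjk)
    exact (hstep j).1 (h.symm.trans h6)
  refine ⟨?_, B _, ?_⟩
  · intro j k h
    rcases lt_trichotomy j k with hlt | heq | hlt
    · exact absurd (h ▸ (hstep k).2.1) (C j k hlt)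
    · exact heq
    · exact absurd (h ▸ (hstep j).2.1) (C k j hlt)
  · intro L hL v hv hpv
    obtain ⟨k, rfl⟩ := B _ v hv
    obtain ⟨j, hj⟩ := B _ _ hpv
    have hs := A (Fin.last m) k (Fin.castSucc_lt_last k)
    rw [hj, hL, hL]
    apply hℓ
    by_contra hlt
    apply C j k (not_le.mp hlt)
    rw [← hj, hs]
    exact (hstep k).2.2.1
end
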